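/- arXiv:cs/0504023 — 2 statements merged into one kernel-verified Lean document; each statement's English description precedes it below -/
import Mathlib

section
/- Set c₁ = 1/20. Let k ≥ 2, let the vertex set V have size n with n ≥ 100·k³, and let D be a k-clustering of a sign-labeled complete graph on V with disagr(D) = γ·n² where γ ≤ c₁/(16k³). Let 0 ≤ β ≤ c₁/(16k²) and let C : V → {1,…,k} be any k-clustering such that for every u ∈ V, pval^D(u, C(u)) ≥ val^D(u) − 2β. Define T_low := {u ∈ V : val^D(u) ≤ 1 − c₁/k²}. Then for every cluster index i with |C⁻¹(i)| ≥ n/(2k), it holds that C⁻¹(i) \ T_low = D⁻¹(i) \ T_low. -/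
open Finset

/-- Whether both endpoints of an unordered pair lie in the same cluster. -/
def sameBlock {V : Type*} {k : ℕ} (c : V → Fin k) : Sym2 V → Bool :=
  Sym2.lift ⟨fun u v => decide (c u = c v), fun u v => by simp [eq_comm]⟩

/-- The edges of the complete graph on `V`: all non-diagonal unordered pairs. -/
def edgeSet (V : Type*) [Fintype V] [DecidableEq V] : Finset (Sym2 V) :=
  Finset.univ.filter fun e => ¬ e.IsDiag

/-- number of edges agreeing with the clustering `c` under labeling `L`
(`true` = `+`, `false` = `-`). -/
def agreeCount {V : Type*} [Fintype V] [DecidableEq V] {k : ℕ}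
    (L : Sym2 V → Bool) (c : V → Fin k) : ℕ :=
  ((edgeSet V).filter fun e => sameBlock c e = L e).card

/-- number of edges disagreeing with the clustering `c`. -/
def disagreeCount {V : Type*} [Fintype V] [DecidableEq V] {k : ℕ}
    (L : Sym2 V → Bool) (c : V → Fin k) : ℕ :=
  ((edgeSet V).filter fun e => sameBlock c e ≠ L e).card

/-- `val^c(u)`: the fraction of the `n-1` edges incident to `u` agreeing with `c`. -/
noncomputable def valAt {V : Type*} [Fintype V] [DecidableEq V] {k : ℕ}
    (L : Sym2 V → Bool) (c : V → Fin k) (u : V) : ℝ :=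
  (((edgeSet V).filter fun e => u ∈ e ∧ sameBlock c e = L e).card : ℝ)
    / ((Fintype.card V : ℝ) - 1)

/-- `pval^c(u,i)`: fraction of edges incident to `u` agreeing with `c^{(u,i)}`. -/
noncomputable def pval {V : Type*} [Fintype V] [DecidableEq V] {k : ℕ}
    (L : Sym2 V → Bool) (c : V → Fin k) (u : V) (i : Fin k) : ℝ :=
  valAt L (Function.update c u i) u

theorem card_edgeSet_filter_incident {V : Type*} [Fintype V] [DecidableEq V]
    (u : V) (P : Sym2 V → Prop) [DecidablePred P] :
    ((edgeSet V).filter fun e => u ∈ e ∧ P e).card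
      = (univ.filter fun v : V => v ≠ u ∧ P s(u, v)).card := by
  symm
  apply card_bij (fun v _ => s(u, v))
  · intro v hv
    simp only [mem_filter, mem_univ, true_and] at hv
    simp only [edgeSet, mem_filter, mem_univ, true_and, Sym2.mk_isDiag_iff]
    exact ⟨fun h => hv.1 h.symm, Sym2.mem_mk_left u v, hv.2⟩
  · intro a _ b _ h
    exact Sym2.congr_right.mp h
  · intro e he
    simp only [edgeSet, mem_filter, mem_univ, true_and] at he
    obtain ⟨hd, hu, hP⟩ := he
    obtain ⟨v, rfl⟩ := Sym2.mem_iff_exists.mp hu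
    refine ⟨v, ?_, rfl⟩
    simp only [mem_filter, mem_univ, true_and]
    exact ⟨fun h => hd (by simp [h]), hP⟩

theorem card_agree_add_card_disagree {V : Type*} [Fintype V] [DecidableEq V] {k : ℕ}
    (L : Sym2 V → Bool) (c : V → Fin k) (u : V) :
    ((edgeSet V).filter fun e => u ∈ e ∧ sameBlock c e = L e).card
      + ((edgeSet V).filter fun e => u ∈ e ∧ sameBlock c e ≠ L e).card + 1
      = Fintype.card V := by
  rw [card_edgeSet_filter_incident, card_edgeSet_filter_incident, ← filter_filter,
    ← filter_filter, card_filter_add_card_filter_not, filter_ne', card_erase_of_mem (mem_univ u),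
    card_univ]
  have : 0 < Fintype.card V := Fintype.card_pos_iff.mpr ⟨u⟩
  omega

theorem sum_card_disagree_le {V : Type*} [Fintype V] [DecidableEq V] {k : ℕ}
    (L : Sym2 V → Bool) (c : V → Fin k) :
    ∑ u : V, ((edgeSet V).filter fun e => u ∈ e ∧ sameBlock c e ≠ L e).card
      ≤ 2 * disagreeCount L c := by
  have h1 : ∀ u : V, ((edgeSet V).filter fun e => u ∈ e ∧ sameBlock c e ≠ L e)
      = bipartiteAbove (fun (u : V) (e : Sym2 V) => u ∈ e)
        ((edgeSet V).filter fun e => sameBlock c e ≠ L e) u := by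
    intro u
    ext e
    simp only [bipartiteAbove, mem_filter]
    tauto
  simp_rw [h1]
  rw [sum_card_bipartiteAbove_eq_sum_card_bipartiteBelow, disagreeCount, mul_comm,
    ← smul_eq_mul]
  apply sum_le_card_nsmul
  intro e _
  induction e with
  | _ a b =>
    calc _ ≤ ({a, b} : Finset V).card := by
          apply card_le_card
          intro x hx
          simpa [bipartiteBelow] using hx
      _ ≤ 2 := card_le_two

/-- Moving `u` to another cluster flips the agreement of every edge from `u` to its old and its
new cluster. -/
theorem card_agree_add_card_agree_update_le {V : Type*} [Fintype V] [DecidableEq V] {k : ℕ}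
    (L : Sym2 V → Bool) (c : V → Fin k) (u : V) (i : Fin k) (hi : c u ≠ i) :
    ((edgeSet V).filter fun e => u ∈ e ∧ sameBlock c e = L e).card
      + ((edgeSet V).filter fun e => u ∈ e ∧ sameBlock (Function.update c u i) e = L e).card
      + (univ.filter fun x => c x = i).card + (univ.filter fun x => c x = c u).card + 1
      ≤ 2 * Fintype.card V := by
  rw [card_edgeSet_filter_incident, card_edgeSet_filter_incident]
  set A := univ.filter fun v : V => v ≠ u ∧ sameBlock c s(u, v) = L s(u, v) with hA
  set B := univ.filter fun v : V => v ≠ u ∧ sameBlock (Function.update c u i) s(u, v) = L s(u, v)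
    with hB
  set X := univ.filter fun x => c x = i
  set Y := univ.filter fun x => c x = c u
  have hXY : Disjoint X Y := by
    rw [disjoint_filter]
    intro x _ h1 h2
    exact hi (h2.symm.trans h1)
  have h1 : (A ∪ B).card + 1 ≤ Fintype.card V := by
    have : u ∉ A ∪ B := by simp [hA, hB]
    rw [← card_insert_of_notMem this]
    exact card_le_univ _
  have h2 : Disjoint (A ∩ B) (X ∪ Y) := by
    rw [disjoint_left]
    intro x hx hxy
    obtain ⟨hxA, hxB⟩ := mem_inter.mp hx
    obtain ⟨hne, h3⟩ := (mem_filter.mp hxA).2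
    obtain ⟨-, h4⟩ := (mem_filter.mp hxB).2
    simp only [sameBlock, Sym2.lift_mk, Function.update_self] at h3 h4
    rw [Function.update_of_ne hne, ← h3, decide_eq_decide] at h4
    have hxy : c x = i ∨ c x = c u := by simpa [X, Y] using hxy
    rcases hxy with h | h
    · exact hi ((h4.mp h.symm).trans h)
    · exact hi ((h4.mpr h.symm).trans h).symm
  have h3 : (A ∩ B).card + (X.card + Y.card) ≤ Fintype.card V := by
    rw [← card_union_of_disjoint hXY, ← card_union_of_disjoint h2]
    exact card_le_univ _
  have h4 := card_union_add_card_inter A B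
  omega

theorem valAt_add_pval_le {V : Type*} [Fintype V] [DecidableEq V] {k : ℕ}
    (L : Sym2 V → Bool) (c : V → Fin k) (u : V) (i : Fin k) (hi : c u ≠ i)
    (hV : 1 < Fintype.card V) :
    (valAt L c u + pval L c u i) * ((Fintype.card V : ℝ) - 1)
      + (univ.filter fun x => c x = i).card + (univ.filter fun x => c x = c u).card
      ≤ 2 * ((Fintype.card V : ℝ) - 1) + 1 := by
  have hm : ((Fintype.card V : ℝ) - 1) ≠ 0 := by
    have : (1 : ℝ) < Fintype.card V := by exact_mod_cast hV
    linarith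
  have h := card_agree_add_card_agree_update_le L c u i hi
  rw [pval, valAt, valAt, add_mul, div_mul_cancel₀ _ hm, div_mul_cancel₀ _ hm]
  have h' : (_ : ℝ) ≤ _ := Nat.cast_le.mpr h
  push_cast at h'
  linarith

theorem card_valAt_le_mul_le {V : Type*} [Fintype V] [DecidableEq V] {k : ℕ}
    (L : Sym2 V → Bool) (c : V → Fin k) (t : ℝ) (hV : 1 < Fintype.card V) :
    ((univ.filter fun u => valAt L c u ≤ 1 - t).card : ℝ) * (t * ((Fintype.card V : ℝ) - 1))
      ≤ 2 * disagreeCount L c := by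
  have hm : 0 < ((Fintype.card V : ℝ) - 1) := by
    have : (1 : ℝ) < Fintype.card V := by exact_mod_cast hV
    linarith
  have h : ((_ : ℕ) : ℝ) ≤ _ := Nat.cast_le.mpr (sum_card_disagree_le L c)
  push_cast at h
  refine le_trans ?_ h
  rw [← nsmul_eq_mul]
  refine (card_nsmul_le_sum _
    (fun u => (((edgeSet V).filter fun e => u ∈ e ∧ sameBlock c e ≠ L e).card : ℝ)) _ ?_).trans
    (sum_le_sum_of_subset_of_nonneg (subset_univ _) fun _ _ _ => Nat.cast_nonneg _)
  intro u hu
  rw [mem_filter, valAt, div_le_iff₀ hm] at hu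
  have h2 : ((_ : ℕ) : ℝ) = _ := congrArg Nat.cast (card_agree_add_card_disagree L c u)
  push_cast at h2
  linarith [hu.2]

/-- with c₁ = 1/20, k ≥ 2, n ≥ 100k³, disagr(D) = γn² for
γ ≤ c₁/(16k³), 0 ≤ β ≤ c₁/(16k²), and C a clustering placing every u in a
cluster of pval at least val^D(u) - 2β, every cluster of C of size ≥ n/(2k)
agrees with the corresponding cluster of D outside T_low. -/
theorem stmt_8 {V : Type*} [Fintype V] [DecidableEq V]
    (L : Sym2 V → Bool) {k : ℕ} (hk : 2 ≤ k)
    (hn : 100 * k ^ 3 ≤ Fintype.card V)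
    (c₁ : ℝ) (hc₁ : c₁ = 1 / 20)
    (D : V → Fin k) (γ β : ℝ)
    (hγ : (disagreeCount L D : ℝ) = γ * (Fintype.card V : ℝ) ^ 2)
    (hγ' : γ ≤ c₁ / (16 * (k : ℝ) ^ 3))
    (hβ0 : 0 ≤ β) (hβ : β ≤ c₁ / (16 * (k : ℝ) ^ 2))
    (C : V → Fin k)
    (hC : ∀ u : V, valAt L D u - 2 * β ≤ pval L D u (C u))
    (i : Fin k)
    (hi : (Fintype.card V : ℝ) / (2 * (k : ℝ))
            ≤ ((Finset.univ.filter fun x => C x = i).card : ℝ)) :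
    (Finset.univ.filter fun x => C x = i)
        \ (Finset.univ.filter fun u => valAt L D u ≤ 1 - c₁ / (k : ℝ) ^ 2)
      = (Finset.univ.filter fun x => D x = i)
        \ (Finset.univ.filter fun u => valAt L D u ≤ 1 - c₁ / (k : ℝ) ^ 2) := by
  have hk' : (2 : ℝ) ≤ k := by exact_mod_cast hk
  have hn' : 100 * (k : ℝ) ^ 3 ≤ Fintype.card V := by exact_mod_cast hn
  set n : ℝ := (Fintype.card V : ℝ) with hndef
  have hk0 : (0 : ℝ) < k := by linarith
  have hk3 : (8 : ℝ) ≤ (k : ℝ) ^ 3 := by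
    have := pow_le_pow_left₀ (by norm_num) hk' 3
    norm_num at this
    exact this
  have hn800 : (800 : ℝ) ≤ n := by linarith
  have hV : 1 < Fintype.card V := by
    have : (1 : ℝ) < (Fintype.card V : ℝ) := by linarith
    exact_mod_cast this
  set T := univ.filter fun u => valAt L D u ≤ 1 - c₁ / (k : ℝ) ^ 2 with hT
  set S : ℝ := 1 + 17 / 160 * n / (k : ℝ) ^ 2 with hS
  have hTcard : (T.card : ℝ) ≤ n / (7 * k) := by
    have h1 := card_valAt_le_mul_le L D (c₁ / (k : ℝ) ^ 2) hV
    rw [hγ, ← hT, ← hndef, hc₁] at h1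
    have h2 : γ * n ^ 2 ≤ (1 / 20) / (16 * (k : ℝ) ^ 3) * n ^ 2 := by
      rw [hc₁] at hγ'
      gcongr
    have h3 : (T.card : ℝ) * (n - 1) ≤ n ^ 2 / (8 * k) := by
      have h4 : (T.card : ℝ) * (n - 1)
          = (T.card * (1 / 20 / (k : ℝ) ^ 2 * (n - 1))) * (20 * (k : ℝ) ^ 2) := by
        field_simp
      rw [h4]
      calc _ ≤ (2 * ((1 / 20) / (16 * (k : ℝ) ^ 3) * n ^ 2)) * (20 * (k : ℝ) ^ 2) := by
            exact mul_le_mul_of_nonneg_right (by linarith) (by positivity)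
        _ = n ^ 2 / (8 * k) := by
            field_simp
            norm_num
    refine le_of_mul_le_mul_right (h3.trans ?_) (by linarith : 0 < n - 1)
    rw [div_mul_eq_mul_div, div_le_div_iff₀ (by positivity) (by positivity)]
    have : n * (7 * n) ≤ n * (8 * (n - 1)) :=
      mul_le_mul_of_nonneg_left (by linarith) (by linarith)
    nlinarith
  have hkS : (k : ℝ) * S < n / (2 * k) - n / (7 * k) := by
    have h1 : (k : ℝ) * S = (k ^ 2 + 17 / 160 * n) / k := by
      rw [hS]
      field_simp
    have h2 : n / (2 * k) - n / (7 * k) = (5 / 14 * n) / k := by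
      field_simp
      norm_num
    rw [h1, h2]
    gcongr
    nlinarith [sq_nonneg (k : ℝ)]
  have hS0 : 0 ≤ S := by positivity
  have hsmall : ∀ u ∉ T, D u ≠ C u →
      ((univ.filter fun x => D x = C u).card : ℝ) ≤ S
        ∧ ((univ.filter fun x => D x = D u).card : ℝ) ≤ S := by
    intro u hu hne
    have h1 := valAt_add_pval_le L D u (C u) hne hV
    rw [← hndef] at h1
    have h2 : 1 - c₁ / (k : ℝ) ^ 2 < valAt L D u := by simpa [hT] using hu
    have h3 : 2 - 17 / 160 / (k : ℝ) ^ 2 ≤ valAt L D u + pval L D u (C u) := by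
      have h4 : 17 / 160 / (k : ℝ) ^ 2
          = 2 * (c₁ / (k : ℝ) ^ 2) + 2 * (c₁ / (16 * (k : ℝ) ^ 2)) := by
        rw [hc₁]
        field_simp
        norm_num
      linarith [hC u]
    have h5 := mul_le_mul_of_nonneg_right h3 (by linarith : 0 ≤ n - 1)
    have h6 : 17 / 160 * n / (k : ℝ) ^ 2 = 17 / 160 / (k : ℝ) ^ 2 * n := by ring
    have h7 : 0 ≤ 17 / 160 / (k : ℝ) ^ 2 := by positivity
    have h8 : (0 : ℝ) ≤ ((univ.filter fun x => D x = C u).card : ℝ) := Nat.cast_nonneg _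
    have h9 : (0 : ℝ) ≤ ((univ.filter fun x => D x = D u).card : ℝ) := Nat.cast_nonneg _
    rw [hS, h6]
    constructor <;> linarith
  set Ci := univ.filter fun x => C x = i with hCi
  have hbig : k * S < ((Ci \ T).card : ℝ) := by
    have h1 : (Ci.card : ℝ) ≤ T.card + (Ci \ T).card := by
      have := card_le_card_sdiff_add_card (s := Ci) (t := T)
      have h2 : (_ : ℝ) ≤ _ := Nat.cast_le.mpr this
      push_cast at h2
      linarith
    linarith
  have hsub : ∀ u ∈ Ci \ T, D u = i := by
    intro u hu
    by_contra hne
    obtain ⟨huC, huT⟩ := mem_sdiff.mp hu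
    have huC : C u = i := by simpa [hCi] using huC
    have hDi := (hsmall u huT (by rwa [huC])).1
    rw [huC] at hDi
    have hcard : (Ci \ T).card = ∑ j : Fin k, ((Ci \ T).filter fun x => D x = j).card :=
      card_eq_sum_card_fiberwise fun _ _ => mem_coe.mpr (mem_univ _)
    have hle : ((Ci \ T).card : ℝ) ≤ k * S := by
      rw [hcard]
      push_cast
      refine (sum_le_card_nsmul univ _ S ?_).trans (by simp)
      intro j _
      rcases ((Ci \ T).filter fun x => D x = j).eq_empty_or_nonempty with he | ⟨w, hw⟩
      · rw [he]
        simpa using hS0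
      · obtain ⟨hwCT, rfl⟩ := mem_filter.mp hw
        obtain ⟨hwC, hwT⟩ := mem_sdiff.mp hwCT
        have hwC : C w = i := by simpa [hCi] using hwC
        have hle : ((Ci \ T).filter fun x => D x = D w).card
            ≤ (univ.filter fun x => D x = D w).card :=
          card_le_card (filter_subset_filter _ (subset_univ _))
        refine le_trans (Nat.cast_le.mpr hle) ?_
        by_cases h : D w = i
        · rwa [h]
        · exact (hsmall w hwT (by rwa [hwC])).2
    linarith
  ext u
  constructor
  · intro hu
    exact mem_sdiff.mpr ⟨by simpa using hsub u hu, (mem_sdiff.mp hu).2⟩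
  · intro hu
    obtain ⟨huD, huT⟩ := mem_sdiff.mp hu
    have huD : D u = i := by simpa using huD
    refine mem_sdiff.mpr ⟨?_, huT⟩
    by_contra hne
    have hne : C u ≠ i := by simpa [hCi] using hne
    have h1 := (hsmall u huT (by rw [huD]; exact hne.symm)).2
    rw [huD] at h1
    have h2 : (Ci \ T).card ≤ (univ.filter fun x => D x = i).card :=
      card_le_card fun x hx => by simpa using hsub x hx
    have h2' : ((Ci \ T).card : ℝ) ≤ ((univ.filter fun x => D x = i).card : ℝ) :=
      Nat.cast_le.mpr h2
    nlinarith
end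

section
/- Let G be a simple graph on a vertex set V of even size n ≥ 2 with |E(G)| edges. Form the sign-labeled complete graph G' on the vertex set V × {0,1,…,n}, where the edge between distinct vertices (u,a) and (v,b) is labeled + if u = v, or if a = 0, b = 0 and {u,v} is an edge of G; all other edges are labeled −. Then the minimum, over all 2-clusterings of G', of the number of disagreements equals (n/2)·(n/2 − 1)·(n+1)² − |E(G)| + 2·b(G), where b(G) is the minimum, over all subsets S ⊆ V with |S| = n/2, of the number of edges of G with exactly one endpoint in S (the minimum bisection width of G). -/
open Finset

/-- Labeling of the complete graph on V × Fin (n+1) from a simple graph G: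
the edge between (u,a) and (v,b) is + iff u = v (same group), or
a = 0, b = 0 and {u,v} is an edge of G. -/
def biasLabel {V : Type*} [DecidableEq V] (G : SimpleGraph V) [DecidableRel G.Adj]
    (n : ℕ) : Sym2 (V × Fin (n + 1)) → Bool :=
  Sym2.lift
    ⟨fun p q => decide (p.1 = q.1 ∨ (p.2 = 0 ∧ q.2 = 0 ∧ G.Adj p.1 q.1)),
     fun p q => by
        apply decide_eq_decide.mpr
        constructor
        · rintro (h | ⟨h1, h2, h3⟩)
          · exact Or.inl h.symm
          · exact Or.inr ⟨h2, h1, h3.symm⟩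
        · rintro (h | ⟨h1, h2, h3⟩)
          · exact Or.inl h.symm
          · exact Or.inr ⟨h2, h1, h3.symm⟩⟩

/-- Whether an unordered pair crosses the cut given by S. -/
def crossesCut {V : Type*} [DecidableEq V] (S : Finset V) : Sym2 V → Bool :=
  Sym2.lift ⟨fun u v => xor (decide (u ∈ S)) (decide (v ∈ S)),
    fun u v => Bool.xor_comm _ _⟩

theorem two_mul_card_edgeSet_filter {V : Type*} [Fintype V] [DecidableEq V]
    (P : Sym2 V → Prop) [DecidablePred P] :
    2 * ((edgeSet V).filter P).card =
      (univ.filter fun p : V × V => p.1 ≠ p.2 ∧ P s(p.1, p.2)).card := by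
  have hmaps : ∀ p ∈ univ.filter fun p : V × V => p.1 ≠ p.2 ∧ P s(p.1, p.2),
      s(p.1, p.2) ∈ (edgeSet V).filter P := by
    intro p hp
    simpa [edgeSet] using hp
  rw [card_eq_sum_card_fiberwise hmaps, mul_comm]
  symm
  apply sum_const_nat
  intro e
  induction e using Sym2.ind with
  | _ u v =>
    intro he
    simp only [edgeSet, mem_filter, mem_univ, true_and, Sym2.mk_isDiag_iff] at he
    have hfib : ((univ.filter fun p : V × V => p.1 ≠ p.2 ∧ P s(p.1, p.2)).filter
        fun p => s(p.1, p.2) = s(u, v)) = {(u, v), (v, u)} := by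
      ext ⟨a, b⟩
      simp only [mem_filter, mem_univ, true_and, mem_insert, mem_singleton, Prod.mk.injEq,
        Sym2.eq_iff]
      constructor
      · exact fun h => h.2
      · rintro (⟨rfl, rfl⟩ | ⟨rfl, rfl⟩)
        · exact ⟨he, Or.inl ⟨rfl, rfl⟩⟩
        · exact ⟨⟨Ne.symm he.1, by rw [Sym2.eq_swap]; exact he.2⟩, Or.inr ⟨rfl, rfl⟩⟩
    rw [hfib, card_pair]
    intro h
    exact he.1 (Prod.mk.inj h).1

/-- The cluster containing `p`, encoded as a sign. -/
def clusterSign {W : Type*} (c : W → Fin 2) (p : W) : ℤ := if c p = 0 then 1 else -1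

/-- The indicator of membership in `S`, as a sign. -/
def cutSign {V : Type*} [DecidableEq V] (S : Finset V) (v : V) : ℤ := if v ∈ S then 1 else -1

theorem four_mul_disagreeCount {V : Type*} [Fintype V] [DecidableEq V]
    (G : SimpleGraph V) [DecidableRel G.Adj] (n : ℕ) (c : V × Fin (n + 1) → Fin 2) :
    4 * (disagreeCount (biasLabel G n) c : ℤ) =
      (Fintype.card V : ℤ) ^ 2 * ((n : ℤ) + 1) ^ 2
        + (∑ u, ∑ a, clusterSign c (u, a)) ^ 2
        - 2 * ∑ u, (∑ a, clusterSign c (u, a)) ^ 2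
        - 2 * ∑ u, ∑ v, if G.Adj u v then clusterSign c (u, 0) * clusterSign c (v, 0) else 0 := by
  have h1 : 2 * disagreeCount (biasLabel G n) c = (univ.filter
      fun p : (V × Fin (n + 1)) × (V × Fin (n + 1)) =>
        p.1 ≠ p.2 ∧ sameBlock c s(p.1, p.2) ≠ biasLabel G n s(p.1, p.2)).card :=
    two_mul_card_edgeSet_filter _
  have h2 : ∀ p q : V × Fin (n + 1),
      (2 * if p ≠ q ∧ sameBlock c s(p, q) ≠ biasLabel G n s(p, q) then 1 else 0 : ℤ) =
        1 + clusterSign c p * clusterSign c q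
        - 2 * (if p.1 = q.1 then clusterSign c p * clusterSign c q else 0)
        - 2 * (if p.2 = 0 then if q.2 = 0 then if G.Adj p.1 q.1 then
            clusterSign c p * clusterSign c q else 0 else 0 else 0) := by
    intro p q
    have hc : c p = c q ↔ (c p = 0 ↔ c q = 0) := by
      generalize c p = a
      generalize c q = b
      revert a b
      decide
    have hirr : p.1 = q.1 → ¬ G.Adj p.1 q.1 := fun h h' => h'.ne h
    by_cases hpq : p = q
    · subst hpq
      by_cases hp : c p = 0 <;> simp [clusterSign, hp]
    · simp only [sameBlock, biasLabel, Sym2.lift_mk, hc, clusterSign, ne_eq, decide_eq_decide]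
      by_cases hp : c p = 0 <;> by_cases hq : c q = 0 <;> by_cases huv : p.1 = q.1 <;>
        by_cases ha : p.2 = 0 <;> by_cases hb : q.2 = 0 <;> by_cases hG : G.Adj p.1 q.1 <;>
        simp_all
  have h3 : (2 * disagreeCount (biasLabel G n) c : ℤ) =
      ∑ p : V × Fin (n + 1), ∑ q : V × Fin (n + 1),
        if p ≠ q ∧ sameBlock c s(p, q) ≠ biasLabel G n s(p, q) then 1 else 0 := by
    rw [← Fintype.sum_prod_type', sum_boole]
    exact_mod_cast h1
  have h4 : (4 * disagreeCount (biasLabel G n) c : ℤ) = 2 * (2 * disagreeCount (biasLabel G n) c) := by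
    ring
  rw [h4, h3, mul_sum]
  simp_rw [mul_sum, h2, sum_sub_distrib, sum_add_distrib, ← mul_sum]
  congr 1
  · congr 1
    · congr 1
      · simp
        ring
      · rw [← sum_mul, ← Fintype.sum_prod_type', sq]
    · congr 1
      rw [Fintype.sum_prod_type]
      refine sum_congr rfl fun u _ => ?_
      rw [sq, sum_mul]
      refine sum_congr rfl fun a _ => ?_
      rw [Fintype.sum_prod_type_right, mul_sum]
      refine sum_congr rfl fun b _ => ?_
      simp
  · congr 1
    rw [Fintype.sum_prod_type]
    refine sum_congr rfl fun u _ => ?_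
    rw [sum_eq_single (0 : Fin (n + 1)) (by intro a _ ha; simp [ha]) (by simp)]
    rw [Fintype.sum_prod_type]
    refine sum_congr rfl fun v _ => ?_
    rw [sum_eq_single (0 : Fin (n + 1)) (by intro a _ ha; simp [ha]) (by simp)]
    simp

theorem sum_adj_cutSign {V : Type*} [Fintype V] [DecidableEq V]
    (G : SimpleGraph V) [DecidableRel G.Adj] (S : Finset V) :
    (∑ u, ∑ v, if G.Adj u v then cutSign S u * cutSign S v else 0) =
      2 * (G.edgeFinset.card : ℤ)
        - 4 * ((G.edgeFinset.filter fun e => crossesCut S e = true).card : ℤ) := by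
  have key : ∀ (P : Sym2 V → Prop) [DecidablePred P],
      2 * ((G.edgeFinset.filter P).card : ℤ) =
        ∑ u, ∑ v, if G.Adj u v ∧ P s(u, v) then 1 else 0 := by
    intro P _
    have h1 : G.edgeFinset.filter P = (edgeSet V).filter fun e => e ∈ G.edgeFinset ∧ P e := by
      ext e
      simp only [edgeSet, mem_filter, mem_univ, true_and]
      refine ⟨fun h => ⟨?_, h⟩, fun h => h.2⟩
      exact G.not_isDiag_of_mem_edgeFinset h.1
    have h2 := two_mul_card_edgeSet_filter fun e => e ∈ G.edgeFinset ∧ P e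
    rw [← h1] at h2
    rw [← Fintype.sum_prod_type', sum_boole]
    have h3 : (univ.filter fun p : V × V => G.Adj p.1 p.2 ∧ P s(p.1, p.2)) =
        univ.filter fun p : V × V => p.1 ≠ p.2 ∧ s(p.1, p.2) ∈ G.edgeFinset ∧ P s(p.1, p.2) := by
      ext p
      simp only [mem_filter, mem_univ, true_and, SimpleGraph.mem_edgeFinset,
        SimpleGraph.mem_edgeSet]
      exact ⟨fun h => ⟨h.1.ne, h⟩, fun h => h.2⟩
    rw [h3]
    exact_mod_cast h2
  have hE := key fun _ => True
  have hC := key fun e => crossesCut S e = true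
  rw [filter_true] at hE
  have h4 : 4 * ((G.edgeFinset.filter fun e => crossesCut S e = true).card : ℤ) =
      2 * (2 * ((G.edgeFinset.filter fun e => crossesCut S e = true).card : ℤ)) := by ring
  rw [h4, hE, hC]
  simp_rw [mul_sum, ← sum_sub_distrib]
  refine sum_congr rfl fun u _ => sum_congr rfl fun v _ => ?_
  by_cases hG : G.Adj u v <;> by_cases hu : u ∈ S <;> by_cases hv : v ∈ S <;>
    simp [hG, hu, hv, cutSign, crossesCut]

theorem card_cut_le_add_symmDiff {V : Type*} [Fintype V] [DecidableEq V]
    (G : SimpleGraph V) [DecidableRel G.Adj] (S T : Finset V) :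
    (G.edgeFinset.filter fun e => crossesCut T e = true).card ≤
      (G.edgeFinset.filter fun e => crossesCut S e = true).card
        + (symmDiff S T).card * Fintype.card V := by
  have hsub : (G.edgeFinset.filter fun e => crossesCut T e = true) ⊆
      (G.edgeFinset.filter fun e => crossesCut S e = true) ∪
        (symmDiff S T).biUnion fun v => G.incidenceFinset v := by
    intro e he
    induction e using Sym2.ind with
    | _ u v =>
      rw [mem_filter, SimpleGraph.mem_edgeFinset] at he
      obtain ⟨he, h⟩ := he
      simp only [mem_union, mem_biUnion, SimpleGraph.mem_incidenceFinset, mem_filter,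
        SimpleGraph.mem_edgeFinset]
      by_cases hu : u ∈ symmDiff S T
      · exact Or.inr ⟨u, hu, he, Sym2.mem_mk_left u v⟩
      by_cases hv : v ∈ symmDiff S T
      · exact Or.inr ⟨v, hv, he, Sym2.mem_mk_right u v⟩
      refine Or.inl ⟨he, ?_⟩
      rw [mem_symmDiff] at hu hv
      have hu' : u ∈ S ↔ u ∈ T := by tauto
      have hv' : v ∈ S ↔ v ∈ T := by tauto
      simpa [crossesCut, hu', hv'] using h
  refine (card_le_card hsub).trans ((card_union_le _ _).trans ?_)
  gcongr
  refine card_biUnion_le_card_mul _ _ _ fun v _ => ?_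
  rw [SimpleGraph.card_incidenceFinset_eq_degree]
  exact (G.degree_lt_card_verts v).le

theorem exists_card_eq_card_symmDiff {V : Type*} [Fintype V] [DecidableEq V]
    (S : Finset V) {h : ℕ} (hh : h ≤ Fintype.card V) :
    ∃ T : Finset V, T.card = h ∧ ((symmDiff S T).card : ℤ) = |(S.card : ℤ) - h| := by
  rcases le_total h S.card with hS | hS
  · obtain ⟨T, hT, hc⟩ := exists_subset_card_eq hS
    refine ⟨T, hc, ?_⟩
    have := card_sdiff_add_card_eq_card hT
    rw [symmDiff_of_ge (by exact hT), abs_of_nonneg (by omega)]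
    omega
  · obtain ⟨T, hT, -, hc⟩ := exists_subsuperset_card_eq (subset_univ S) hS (by simpa using hh)
    refine ⟨T, hc, ?_⟩
    have := card_sdiff_add_card_eq_card hT
    rw [symmDiff_of_le (by exact hT), abs_of_nonpos (by omega)]
    omega

theorem sum_cutSign {V : Type*} [Fintype V] [DecidableEq V] (S : Finset V) :
    ∑ v, cutSign S v = 2 * (S.card : ℤ) - Fintype.card V := by
  have h : ∀ v, cutSign S v = 2 * (if v ∈ S then 1 else 0) - 1 := by
    intro v
    by_cases hv : v ∈ S <;> simp [cutSign, hv]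
  simp_rw [h, sum_sub_distrib, ← mul_sum]
  simp

/-- A family of signs `s` perturbed by minority counts `j` pays, through the deficit in
the squares and the imbalance, at least a multiple of the imbalance of `s`. -/
theorem eight_mul_imbalance_le {V : Type*} [Fintype V] {n : ℤ} (hn : 2 ≤ n) (k : ℤ)
    (s j : V → ℤ) (hs : ∀ u, s u = 1 ∨ s u = -1) (hj0 : ∀ u, 0 ≤ j u) (hjn : ∀ u, j u ≤ n)
    (hk : ∑ u, s u = 2 * k) :
    8 * |k| * n ≤ (∑ u, s u * (n + 1 - 2 * j u)) ^ 2
      + 2 * ∑ u, ((n + 1) ^ 2 - (s u * (n + 1 - 2 * j u)) ^ 2) := by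
  set R : ℤ := ∑ u, if j u = 0 then 0 else 1 with hR
  have hR0 : 0 ≤ R := sum_nonneg fun u _ => by split_ifs <;> norm_num
  have hdef : 4 * n * R ≤ ∑ u, ((n + 1) ^ 2 - (s u * (n + 1 - 2 * j u)) ^ 2) := by
    rw [hR, mul_sum]
    refine sum_le_sum fun u _ => ?_
    have hsq : s u ^ 2 = 1 := by rcases hs u with h | h <;> simp [h]
    rw [mul_pow, hsq]
    split_ifs with h
    · simp [h]
    · have h1 : 1 ≤ j u := by have := hj0 u; omega
      nlinarith [mul_nonneg (sub_nonneg.2 h1) (sub_nonneg.2 (hjn u))]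
  have hJ : |∑ u, s u * j u| ≤ n * R := by
    refine (abs_sum_le_sum_abs _ _).trans ?_
    rw [hR, mul_sum]
    refine sum_le_sum fun u _ => ?_
    have habs : |s u| = 1 := by rcases hs u with h | h <;> simp [h]
    rw [abs_mul, habs, one_mul, abs_of_nonneg (hj0 u)]
    split_ifs with h
    · simp [h]
    · simpa using hjn u
  have hT : ∑ u, s u * (n + 1 - 2 * j u) = 2 * (k * (n + 1) - ∑ u, s u * j u) := by
    have h : ∀ u, s u * (n + 1 - 2 * j u) = s u * (n + 1) - 2 * (s u * j u) := fun u => by ring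
    simp_rw [h, sum_sub_distrib, ← mul_sum, ← sum_mul, hk]
    ring
  rw [hT]
  have hτ : |k| * (n + 1) - n * R ≤ |k * (n + 1) - ∑ u, s u * j u| := by
    have h := abs_sub_abs_le_abs_sub (k * (n + 1)) (∑ u, s u * j u)
    rw [abs_mul, abs_of_pos (by linarith : (0 : ℤ) < n + 1)] at h
    linarith
  rw [mul_pow, ← sq_abs (k * (n + 1) - ∑ u, s u * j u)]
  generalize |k * (n + 1) - ∑ u, s u * j u| = τ at hτ
  have hk0 := abs_nonneg k
  generalize |k| = K at *
  rcases le_or_gt K R with h | h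
  · nlinarith [sq_nonneg τ, mul_nonneg (by linarith : 0 ≤ n) (sub_nonneg.2 h)]
  · have h1 : n * (K - R) ≤ τ := by nlinarith
    have h2 : 1 ≤ K - R := by omega
    have h3 : 2 ≤ n * (K - R) := by nlinarith
    have h4 : 2 * (n * (K - R)) ≤ τ ^ 2 := by nlinarith
    nlinarith

theorem exists_minority_count {W : Type*} {n : ℕ} (u : W) (c : W × Fin (n + 1) → Fin 2) :
    ∃ j : ℤ, 0 ≤ j ∧ j ≤ n ∧
      ∑ a, clusterSign c (u, a) = clusterSign c (u, 0) * (n + 1 - 2 * j) := by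
  refine ⟨((univ.filter fun a => c (u, a) ≠ c (u, 0)).card : ℤ), by positivity, ?_, ?_⟩
  · have h : (univ.filter fun a => c (u, a) ≠ c (u, 0)).card < (univ : Finset (Fin (n + 1))).card :=
      card_lt_card ⟨filter_subset _ _, fun h => by simpa using h (mem_univ 0)⟩
    rw [card_univ, Fintype.card_fin] at h
    omega
  · have h : ∀ a, clusterSign c (u, a) =
        clusterSign c (u, 0) * (1 - 2 * if c (u, a) ≠ c (u, 0) then 1 else 0) := by
      intro a
      unfold clusterSign
      generalize c (u, a) = x
      generalize c (u, 0) = y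
      revert x y
      decide
    rw [sum_congr rfl fun a _ => h a, ← mul_sum, sum_sub_distrib, ← mul_sum, sum_boole]
    simp

/-- the minimum number of disagreements over all 2-clusterings of the
derived labeled complete graph equals (n/2)(n/2 - 1)(n+1)² - |E(G)| + 2·b(G), where
b(G) is the minimum bisection width of G. -/
theorem stmt_11 {V : Type*} [Fintype V] [DecidableEq V]
    (G : SimpleGraph V) [DecidableRel G.Adj]
    (hn : 2 ≤ Fintype.card V) (heven : Even (Fintype.card V)) :
    ((sInf {d : ℕ | ∃ c : V × Fin (Fintype.card V + 1) → Fin 2,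
        disagreeCount (biasLabel G (Fintype.card V)) c = d} : ℕ) : ℤ)
      = ((Fintype.card V / 2 : ℕ) : ℤ) * (((Fintype.card V / 2 : ℕ) : ℤ) - 1)
            * ((Fintype.card V : ℤ) + 1) ^ 2
        - (G.edgeFinset.card : ℤ)
        + 2 * ((sInf {m : ℕ | ∃ S : Finset V, S.card = Fintype.card V / 2 ∧
            (G.edgeFinset.filter fun e => crossesCut S e = true).card = m} : ℕ) : ℤ) := by
  obtain ⟨h, hh⟩ := heven
  have hhalf : Fintype.card V / 2 = h := by omega
  have hcard : (Fintype.card V : ℤ) = 2 * h := by rw [hh]; push_cast; ring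
  set n := Fintype.card V with hn_def
  have formula : ∀ (c : V × Fin (n + 1) → Fin 2) (S : Finset V),
      (∀ u, clusterSign c (u, 0) = cutSign S u) →
      4 * (disagreeCount (biasLabel G n) c : ℤ) =
        (n : ℤ) ^ 2 * ((n : ℤ) + 1) ^ 2 + (∑ u, ∑ a, clusterSign c (u, a)) ^ 2
          - 2 * ∑ u, (∑ a, clusterSign c (u, a)) ^ 2 - 4 * (G.edgeFinset.card : ℤ)
          + 8 * ((G.edgeFinset.filter fun e => crossesCut S e = true).card : ℤ) := by
    intro c S hS
    rw [four_mul_disagreeCount]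
    simp_rw [hS]
    rw [sum_adj_cutSign]
    ring
  rw [hhalf]
  have hbis : {m : ℕ | ∃ S : Finset V, S.card = h ∧
      (G.edgeFinset.filter fun e => crossesCut S e = true).card = m}.Nonempty := by
    obtain ⟨T, hT, -⟩ := exists_card_eq_card_symmDiff (∅ : Finset V) (h := h) (by omega)
    exact ⟨_, T, hT, rfl⟩
  obtain ⟨S₀, hS₀, hb⟩ := Nat.sInf_mem hbis
  have hmin : ∀ S : Finset V, S.card = h →
      sInf {m : ℕ | ∃ S : Finset V, S.card = h ∧
        (G.edgeFinset.filter fun e => crossesCut S e = true).card = m} ≤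
      (G.edgeFinset.filter fun e => crossesCut S e = true).card :=
    fun S hS => Nat.sInf_le ⟨S, hS, rfl⟩
  generalize sInf {m : ℕ | ∃ S : Finset V, S.card = h ∧
    (G.edgeFinset.filter fun e => crossesCut S e = true).card = m} = b at hb hmin ⊢
  apply le_antisymm
  · set c : V × Fin (n + 1) → Fin 2 := fun p => if p.1 ∈ S₀ then 0 else 1 with hc
    have hsign : ∀ u a, clusterSign c (u, a) = cutSign S₀ u := by
      intro u a
      by_cases hu : u ∈ S₀ <;> simp [clusterSign, cutSign, hc, hu]
    have hle : sInf {d : ℕ | ∃ c : V × Fin (n + 1) → Fin 2,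
        disagreeCount (biasLabel G n) c = d} ≤ disagreeCount (biasLabel G n) c :=
      Nat.sInf_le ⟨c, rfl⟩
    have hf := formula c S₀ fun u => hsign u 0
    have hsq : ∀ u, cutSign S₀ u ^ 2 = 1 := by
      intro u
      by_cases hu : u ∈ S₀ <;> simp [cutSign, hu]
    simp_rw [hsign, sum_const, card_univ, Fintype.card_fin, nsmul_eq_mul, ← mul_sum, mul_pow, hsq,
      sum_cutSign] at hf
    rw [sum_const, card_univ, ← hn_def, hS₀, hb, hcard, nsmul_eq_mul] at hf
    push_cast at hf
    rw [hcard] at hf ⊢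
    have hle' := Int.ofNat_le.2 hle
    linarith
  · obtain ⟨c, hc⟩ : sInf {d : ℕ | ∃ c : V × Fin (n + 1) → Fin 2,
        disagreeCount (biasLabel G n) c = d} ∈ {d : ℕ | ∃ c : V × Fin (n + 1) → Fin 2,
        disagreeCount (biasLabel G n) c = d} := Nat.sInf_mem ⟨_, fun _ => 0, rfl⟩
    rw [← hc]
    set S : Finset V := univ.filter fun u => c (u, 0) = 0 with hS
    have hsign : ∀ u, clusterSign c (u, 0) = cutSign S u := by
      intro u
      simp [clusterSign, cutSign, hS]
    have hf := formula c S hsign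
    choose j hj0 hjn hX using fun u => exists_minority_count u c
    obtain ⟨T, hT, hd⟩ := exists_card_eq_card_symmDiff S (h := h) (by omega)
    have hcut := (hmin T hT).trans (card_cut_le_add_symmDiff G S T)
    zify at hcut
    rw [hd, ← hn_def] at hcut
    have hineq := eight_mul_imbalance_le (n := n) (by exact_mod_cast hn) ((S.card : ℤ) - h)
      (cutSign S) j (fun u => by unfold cutSign; split_ifs <;> simp) hj0 hjn
      (by rw [sum_cutSign, ← hn_def, hcard]; ring)
    simp_rw [hX, hsign] at hf
    rw [sum_sub_distrib, sum_const, card_univ, ← hn_def, nsmul_eq_mul] at hineq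
    generalize ∑ u, cutSign S u * ((n : ℤ) + 1 - 2 * j u) = A at *
    generalize ∑ u, (cutSign S u * ((n : ℤ) + 1 - 2 * j u)) ^ 2 = B at *
    rw [hcard] at *
    linarith
end
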